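/- Let B(K) act on H = HS(K) by left multiplications with separating and cyclic vector x0. For a normal completely bounded map φ : B(K) → B(K), the following are equivalent: (i) φ is k-positive; (ii) ⟨C_φ, ω_{x,x}⟩ ≥ 0 for every x ∈ HS(K) with rank x ≤ k; (iii) ⟨x ⊠ x, D_φ⟩ ≥ 0 for every x ∈ HS(K) with rank x ≤ k. -/

import Mathlib

set_option synthInstance.maxHeartbeats 1000000
set_option maxHeartbeats 1000000

noncomputable section

open scoped InnerProductSpace ComplexOrder
open ContinuousLinearMap

local notation "⟪" x ", " y "⟫" => @inner ℂ _ _ x y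

namespace ChoiInf

variable {H : Type*} [NormedAddCommGroup H] [InnerProductSpace ℂ H] [CompleteSpace H]

/-- The rank one operator `x ⊠ y : z ↦ (z|y)·x = ⟪y, z⟫ • x`
(inner products written with Mathlib's convention: conjugate linear in the
first variable, so that the paper's `(z|y)` is `⟪y, z⟫`). -/
def rankOne (x y : H) : H →L[ℂ] H := (innerSL ℂ y).smulRight x

/-- The trace of an operator, computed relative to a Hilbert basis:
`Tr X = Σᵢ (X eᵢ | eᵢ) = Σᵢ ⟪eᵢ, X eᵢ⟫`.  (For trace class operators this does
not depend on the choice of basis.) -/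
def tr {ι : Type*} (b : HilbertBasis ι ℂ H) (T : H →L[ℂ] H) : ℂ :=
  ∑' i, ⟪b i, T (b i)⟫

/-- The bilinear pairing `⟨A, B⟩ = Tr (A B)` between `B(H)` and `T(H)`. -/
def pairing {ι : Type*} (b : HilbertBasis ι ℂ H) (A T : H →L[ℂ] H) : ℂ :=
  tr b (A ∘L T)

/-- Trace class operators, characterized by nuclear representations
`T = Σₙ xₙ ⊠ yₙ` with `Σₙ ‖xₙ‖‖yₙ‖ < ∞`. -/
def IsTraceClass (T : H →L[ℂ] H) : Prop :=
  ∃ x y : ℕ → H, Summable (fun n => ‖x n‖ * ‖y n‖) ∧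
    ∀ z, T z = ∑' n, ⟪y n, z⟫ • x n

/-- The trace norm, as the infimum of `Σₙ ‖xₙ‖‖yₙ‖` over all nuclear
representations `T = Σₙ xₙ ⊠ yₙ`. -/
def traceNorm (T : H →L[ℂ] H) : ℝ :=
  sInf {c : ℝ | ∃ x y : ℕ → H, HasSum (fun n => ‖x n‖ * ‖y n‖) c ∧
    ∀ z, T z = ∑' n, ⟪y n, z⟫ • x n}

/-- `(Φ, Φst)` is a dual pair:  `Φst` preserves the trace class and
`⟨Φ A, T⟩ = ⟨A, Φst T⟩` for all trace class `T`.  A linear map `Φ` on `B(H)` is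
normal (σ-weakly continuous) precisely when it admits such a predual map `Φst`. -/
def IsNormalPair {ι : Type*} (b : HilbertBasis ι ℂ H)
    (Φ Φst : (H →L[ℂ] H) →ₗ[ℂ] (H →L[ℂ] H)) : Prop :=
  (∀ T, IsTraceClass T → IsTraceClass (Φst T)) ∧
    ∀ A T, IsTraceClass T → pairing b (Φ A) T = pairing b A (Φst T)

/-- Positivity of a `k × k` matrix of operators, i.e. positivity of the
corresponding operator on `H ⊕ ⋯ ⊕ H`. -/
def MatPos {k : ℕ} (A : Fin k → Fin k → (H →L[ℂ] H)) : Prop :=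
  ∀ v : Fin k → H, 0 ≤ ∑ i, ∑ j, ⟪v i, A i j (v j)⟫

/-- The operator on `H ⊕ ⋯ ⊕ H` given by a `k × k` matrix of operators has norm `≤ c`. -/
def matNormLe {k : ℕ} (A : Fin k → Fin k → (H →L[ℂ] H)) (c : ℝ) : Prop :=
  ∀ v w : Fin k → H,
    ‖∑ i, ∑ j, ⟪w i, A i j (v j)⟫‖ ≤
      c * Real.sqrt (∑ i, ‖v i‖ ^ 2) * Real.sqrt (∑ i, ‖w i‖ ^ 2)

/-- A von Neumann algebra is a factor when its center consists of the scalars. -/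
def IsFactor (M : VonNeumannAlgebra H) : Prop :=
  ∀ T ∈ M, T ∈ M.commutant → ∃ c : ℂ, T = c • (1 : H →L[ℂ] H)

/-- `x0` is a cyclic vector for `M`. -/
def Cyclic (M : VonNeumannAlgebra H) (x0 : H) : Prop :=
  Dense {y : H | ∃ A ∈ M, A x0 = y}

/-- `x0` is a separating vector for `M`. -/
def Separating (M : VonNeumannAlgebra H) (x0 : H) : Prop :=
  ∀ A ∈ M, A x0 = 0 → A = 0

/-- `Φ` restricts on `alg(M', M)` to the map `φ̃ : A'B ↦ A'·φ(B)`.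
(Maps `φ : M → M` are encoded as linear maps on `B(H)` sending `M` into `M`;
only the restriction to `M` is relevant.) -/
def ExtendsTilde (M : VonNeumannAlgebra H)
    (φ Φ : (H →L[ℂ] H) →ₗ[ℂ] (H →L[ℂ] H)) : Prop :=
  ∀ A' ∈ M.commutant, ∀ B ∈ M, Φ (A' * B) = A' * φ B

/-- The space `CB^σ_ε(M)` of maps `φ : M → M` such that `φ̃` extends to a normal
map on `B(H)`. -/
def CBSigmaE {ι : Type*} (b : HilbertBasis ι ℂ H) (M : VonNeumannAlgebra H) :
    Set ((H →L[ℂ] H) →ₗ[ℂ] (H →L[ℂ] H)) :=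
  {φ | (∀ B ∈ M, φ B ∈ M) ∧
    ∃ Φ Φst, ExtendsTilde M φ Φ ∧ IsNormalPair b Φ Φst}

/-- `φ` is completely positive as a map on `M`. -/
def IsCPOn (M : VonNeumannAlgebra H) (φ : (H →L[ℂ] H) →ₗ[ℂ] (H →L[ℂ] H)) : Prop :=
  ∀ (k : ℕ) (A : Fin k → Fin k → (H →L[ℂ] H)), (∀ i j, A i j ∈ M) →
    MatPos A → MatPos fun i j => φ (A i j)

/-- `φ` is completely positive (on all of `B(H)`). -/
def IsCPFull (φ : (H →L[ℂ] H) →ₗ[ℂ] (H →L[ℂ] H)) : Prop :=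
  ∀ (k : ℕ) (A : Fin k → Fin k → (H →L[ℂ] H)), MatPos A → MatPos fun i j => φ (A i j)

/-- `c` is a completely bounded bound for `φ` as a map on `M`. -/
def CBBoundOn (M : VonNeumannAlgebra H) (φ : (H →L[ℂ] H) →ₗ[ℂ] (H →L[ℂ] H))
    (c : ℝ) : Prop :=
  ∀ (k : ℕ) (A : Fin k → Fin k → (H →L[ℂ] H)), (∀ i j, A i j ∈ M) →
    matNormLe A 1 → matNormLe (fun i j => φ (A i j)) c

/-- The completely bounded norm of `φ` as a map on `M`. -/
def cbNormOn (M : VonNeumannAlgebra H) (φ : (H →L[ℂ] H) →ₗ[ℂ] (H →L[ℂ] H)) : ℝ :=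
  sInf {c : ℝ | 0 ≤ c ∧ CBBoundOn M φ c}

/-- `φ` is completely bounded as a map on `M`. -/
def IsCBOn (M : VonNeumannAlgebra H) (φ : (H →L[ℂ] H) →ₗ[ℂ] (H →L[ℂ] H)) : Prop :=
  ∃ c, 0 ≤ c ∧ CBBoundOn M φ c

/-- `φ` is normal as a map on `M`: every normal functional composed with `φ`
is again normal (i.e. implemented by a trace class operator). -/
def NormalOn {ι : Type*} (b : HilbertBasis ι ℂ H) (M : VonNeumannAlgebra H)
    (φ : (H →L[ℂ] H) →ₗ[ℂ] (H →L[ℂ] H)) : Prop :=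
  ∀ T, IsTraceClass T → ∃ T', IsTraceClass T' ∧
    ∀ A ∈ M, pairing b (φ A) T = pairing b A T'

/-- The map `Ad_V : X ↦ V* X V`. -/
def AdL (V : H →L[ℂ] H) : (H →L[ℂ] H) →ₗ[ℂ] (H →L[ℂ] H) where
  toFun X := star V * X * V
  map_add' X Y := by simp [add_mul, mul_add]
  map_smul' c X := by simp [smul_mul_assoc, mul_smul_comm]

/-- `p` is a minimal (nonzero) projection in `M`. -/
def IsMinimalProjection (M : VonNeumannAlgebra H) (p : H →L[ℂ] H) : Prop :=
  p ∈ M ∧ IsIdempotentElem p ∧ IsSelfAdjoint p ∧ p ≠ 0 ∧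
    ∀ q, q ∈ M → IsIdempotentElem q → IsSelfAdjoint q → q ≠ 0 →
      q * p = q → p * q = q → q = p

/-- A factor is of type I precisely when it contains a minimal projection. -/
def IsTypeI (M : VonNeumannAlgebra H) : Prop :=
  ∃ p, IsMinimalProjection M p




variable {K : Type*} [NormedAddCommGroup K] [InnerProductSpace ℂ K] [CompleteSpace K]

/-- `T` is a Hilbert–Schmidt operator (relative to a Hilbert basis `e`;
this does not depend on the choice of `e`). -/
def IsHS {ι : Type*} (e : HilbertBasis ι ℂ K) (T : K →L[ℂ] K) : Prop :=
  Summable fun i => ‖T (e i)‖ ^ 2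

/-- A model of the Hilbert space `HS(K)` of Hilbert–Schmidt operators on `K`,
with `B(K)` acting by left multiplications `Lmul` and right multiplications
`Rmul`.  `toOp` regards a vector of `H` as an operator on `K`; its range is
exactly the set of Hilbert–Schmidt operators, and the inner product of `H` is
`(x|y) = Tr (x y*)`, i.e. `⟪x, y⟫ = Σᵢ ⟪x eᵢ, y eᵢ⟫`. -/
structure HSModel {ι : Type*} (e : HilbertBasis ι ℂ K) (H : Type*)
    [NormedAddCommGroup H] [InnerProductSpace ℂ H] [CompleteSpace H] where
  toOp : H →ₗ[ℂ] (K →L[ℂ] K)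
  inj : Function.Injective toOp
  mem_range : ∀ T : K →L[ℂ] K, IsHS e T ↔ ∃ x : H, toOp x = T
  inner_eq : ∀ x y : H, ⟪x, y⟫ = ∑' i, ⟪toOp x (e i), toOp y (e i)⟫
  Lmul : (K →L[ℂ] K) → (H →L[ℂ] H)
  Lmul_eq : ∀ a x, toOp (Lmul a x) = a ∘L toOp x
  Rmul : (K →L[ℂ] K) → (H →L[ℂ] H)
  Rmul_eq : ∀ a x, toOp (Rmul a x) = toOp x ∘L a

/-- The operator `T` has rank at most `k`. -/
def rankLE (T : K →L[ℂ] K) (k : ℕ) : Prop :=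
  Module.rank ℂ (LinearMap.range (T : K →ₗ[ℂ] K)) ≤ (k : Cardinal)

variable {H : Type*} [NormedAddCommGroup H] [InnerProductSpace ℂ H] [CompleteSpace H]
  {ι : Type*} {e : HilbertBasis ι ℂ K}

/-- `Φ` restricts to the map `φ̃ : R_y L_x ↦ R_y L_{φ(x)}` on `alg(M', M)` for
`M = L_{B(K)}`. -/
def HSExt (m : HSModel e H) (φ : (K →L[ℂ] K) →ₗ[ℂ] (K →L[ℂ] K))
    (Φ : (H →L[ℂ] H) →ₗ[ℂ] (H →L[ℂ] H)) : Prop :=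
  ∀ a x : K →L[ℂ] K, Φ (m.Rmul a ∘L m.Lmul x) = m.Rmul a ∘L m.Lmul (φ x)

/-- `φ` is `k`-positive. -/
def kPos (k : ℕ) (φ : (K →L[ℂ] K) →ₗ[ℂ] (K →L[ℂ] K)) : Prop :=
  ∀ A : Fin k → Fin k → (K →L[ℂ] K), MatPos A → MatPos fun i j => φ (A i j)

/-- `φ` is completely bounded (as a map on all of `B(K)`). -/
def IsCBFullK (φ : (K →L[ℂ] K) →ₗ[ℂ] (K →L[ℂ] K)) : Prop :=
  ∃ c, 0 ≤ c ∧ ∀ (k : ℕ) (A : Fin k → Fin k → (K →L[ℂ] K)),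
    matNormLe A 1 → matNormLe (fun i j => φ (A i j)) c

/-- `φ` belongs to `CB^σ(B(K))`: it is normal and completely bounded. -/
def NormalCB (e : HilbertBasis ι ℂ K) (φ : (K →L[ℂ] K) →ₗ[ℂ] (K →L[ℂ] K)) : Prop :=
  (∃ φst, IsNormalPair e φ φst) ∧ IsCBFullK φ

/-- The cone `𝒮_k` of `T(H)`: the trace-norm closed convex cone generated by
the `ω_{x,x} = x ⊠ x` with `rank x ≤ k` (rank as an operator on `K`). -/
def SchmidtCone (m : HSModel e H) (k : ℕ) : Set (H →L[ℂ] H) :=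
  {T | ∀ ε : ℝ, 0 < ε → ∃ (n : ℕ) (x : Fin n → H),
    (∀ i, rankLE (m.toOp (x i)) k) ∧
      traceNorm (T - ∑ i, rankOne (x i) (x i)) < ε}

/-- `ψ` belongs to the convex cone `𝔼_k` generated by the maps `Ad_V` with
`rank V ≤ k`. -/
def InEk (k : ℕ) (ψ : (K →L[ℂ] K) →ₗ[ℂ] (K →L[ℂ] K)) : Prop :=
  ∃ (n : ℕ) (V : Fin n → (K →L[ℂ] K)), (∀ i, rankLE (V i) k) ∧
    ∀ x, ψ x = ∑ i, star (V i) * x * V i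

/-- `φ` (with Choi trace-class operator `Dphi = D_φ`) is `k`-superpositive:
it lies in the `‖·‖_D`-closure of the cone `𝔼_k`, where `‖ψ‖_D = ‖D_ψ‖_{T(H)}`. -/
def kSuper {ιH : Type*} (bH : HilbertBasis ιH ℂ H) (m : HSModel e H) (x0 : H)
    (k : ℕ) (Dphi : H →L[ℂ] H) : Prop :=
  ∀ ε : ℝ, 0 < ε → ∃ ψ Ψ Ψst, InEk k ψ ∧ HSExt m ψ Ψ ∧ IsNormalPair bH Ψ Ψst ∧
    traceNorm (Dphi - Ψst (rankOne x0 x0)) < ε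


section Pairing

variable {E : Type*} [NormedAddCommGroup E] [InnerProductSpace ℂ E]
  {κ : Type*} (b : HilbertBasis κ ℂ E)

@[simp]
lemma rankOne_apply (x y z : E) : rankOne x y z = ⟪y, z⟫ • x := rfl

lemma isTraceClass_rankOne (x y : E) : IsTraceClass (rankOne x y) := by
  refine ⟨Pi.single 0 x, Pi.single 0 y, ?_, fun z => ?_⟩
  · refine summable_of_ne_finset_zero (s := {0}) fun n hn => ?_
    simp [Pi.single_eq_of_ne (by simpa using hn : n ≠ 0)]
  · rw [tsum_eq_single 0]
    · simp
    · intro n hn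
      simp [hn]

lemma pairing_rankOne_right (A : E →L[ℂ] E) (x y : E) :
    pairing b A (rankOne x y) = ⟪y, A x⟫ := by
  rw [← b.tsum_inner_mul_inner y (A x)]
  simp [pairing, tr]

lemma pairing_rankOne_left [CompleteSpace E] (T : E →L[ℂ] E) (x y : E) :
    pairing b (rankOne x y) T = ⟪y, T x⟫ := by
  rw [← adjoint_inner_left, ← b.tsum_inner_mul_inner (adjoint T y) x]
  simp [pairing, tr, adjoint_inner_left]

lemma sum_norm_inner_mul_norm_inner_le (s : Finset κ) (y z : E) :
    ∑ i ∈ s, ‖⟪y, b i⟫‖ * ‖⟪b i, z⟫‖ ≤ ‖y‖ * ‖z‖ := by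
  refine (Real.sum_mul_le_sqrt_mul_sqrt s _ _).trans ?_
  refine mul_le_mul ?_ ?_ (Real.sqrt_nonneg _) (norm_nonneg _)
  · refine Real.sqrt_le_iff.2 ⟨norm_nonneg _, ?_⟩
    simpa only [norm_inner_symm] using b.orthonormal.sum_inner_products_le y (s := s)
  · exact Real.sqrt_le_iff.2 ⟨norm_nonneg _, b.orthonormal.sum_inner_products_le z⟩

lemma pairing_eq_tsum_of_nuclear [CompleteSpace E] (A : E →L[ℂ] E) {T : E →L[ℂ] E} {x y : ℕ → E}
    (hxy : Summable fun n => ‖x n‖ * ‖y n‖) (hT : ∀ z, T z = ∑' n, ⟪y n, z⟫ • x n) :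
    pairing b A T = ∑' n, ⟪y n, A (x n)⟫ := by
  have hsum (z : E) : Summable fun n => ⟪y n, z⟫ • x n := by
    refine Summable.of_norm_bounded (hxy.mul_left ‖z‖) fun n => ?_
    rw [norm_smul]
    calc ‖⟪y n, z⟫‖ * ‖x n‖ ≤ (‖y n‖ * ‖z‖) * ‖x n‖ := by gcongr; exact norm_inner_le_norm _ _
      _ = ‖z‖ * (‖x n‖ * ‖y n‖) := by ring
  have hdiag (i : κ) : ⟪b i, A (T (b i))⟫ = ∑' n, ⟪y n, b i⟫ * ⟪b i, A (x n)⟫ := by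
    rw [hT, A.map_tsum (hsum _), ← innerSL_apply_apply (𝕜 := ℂ),
      ContinuousLinearMap.map_tsum _ ((hsum _).mapL A)]
    simp
  have hprod : Summable fun p : ℕ × κ => ⟪y p.1, b p.2⟫ * ⟪b p.2, A (x p.1)⟫ := by
    refine Summable.of_norm ?_
    simp only [norm_mul]
    have hnn (n : ℕ) (i : κ) : 0 ≤ ‖⟪y n, b i⟫‖ * ‖⟪b i, A (x n)⟫‖ := by positivity
    rw [summable_prod_of_nonneg fun p => hnn p.1 p.2]
    refine ⟨fun n => summable_of_sum_le (hnn n)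
      fun s => sum_norm_inner_mul_norm_inner_le b s (y n) (A (x n)), ?_⟩
    refine Summable.of_nonneg_of_le (fun n => tsum_nonneg (hnn n)) (fun n => ?_)
      (hxy.mul_left ‖A‖)
    refine (Real.tsum_le_of_sum_le (hnn n)
      fun s => sum_norm_inner_mul_norm_inner_le b s (y n) (A (x n))).trans ?_
    calc ‖y n‖ * ‖A (x n)‖ ≤ ‖y n‖ * (‖A‖ * ‖x n‖) := by gcongr; exact A.le_opNorm _
      _ = ‖A‖ * (‖x n‖ * ‖y n‖) := by ring
  calc pairing b A T = ∑' i, ∑' n, ⟪y n, b i⟫ * ⟪b i, A (x n)⟫ := tsum_congr hdiag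
    _ = ∑' n, ∑' i, ⟪y n, b i⟫ * ⟪b i, A (x n)⟫ := by
        exact Summable.tsum_comm (f := fun n i => ⟪y n, b i⟫ * ⟪b i, A (x n)⟫) hprod
    _ = ∑' n, ⟪y n, A (x n)⟫ := tsum_congr fun n => b.tsum_inner_mul_inner _ _

/-- The compression `P A P` of `A`, where `P` is the projection onto the span of `b a`, `a ∈ F`. -/
def compression (F : Finset κ) (A : E →L[ℂ] E) : E →L[ℂ] E :=
  ∑ p : F, ∑ q : F, ⟪b p, A (b q)⟫ • rankOne (b p) (b q)

lemma norm_sum_inner_smul_le (F : Finset κ) (z : E) : ‖∑ a ∈ F, ⟪b a, z⟫ • b a‖ ≤ ‖z‖ := by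
  refine (sq_le_sq₀ (norm_nonneg _) (norm_nonneg _)).1 ?_
  refine le_trans (le_of_eq ?_) (b.orthonormal.sum_inner_products_le z (s := F))
  have h : ((‖∑ a ∈ F, ⟪b a, z⟫ • b a‖ ^ 2 : ℝ) : ℂ) = ((∑ a ∈ F, ‖⟪b a, z⟫‖ ^ 2 : ℝ) : ℂ) := by
    push_cast
    rw [← RCLike.ofReal_eq_complex_ofReal,
      ← inner_self_eq_norm_sq_to_K (𝕜 := ℂ), b.orthonormal.inner_sum]
    exact Finset.sum_congr rfl fun a _ => RCLike.conj_mul _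
  exact_mod_cast h

lemma inner_compression (F : Finset κ) (A : E →L[ℂ] E) (y z : E) :
    ⟪y, compression b F A z⟫ =
      ⟪∑ a ∈ F, ⟪b a, y⟫ • b a, A (∑ a ∈ F, ⟪b a, z⟫ • b a)⟫ := by
  rw [← Finset.sum_coe_sort F, ← Finset.sum_coe_sort F]
  simp only [compression, sum_apply, smul_apply, rankOne_apply, inner_sum, sum_inner, map_sum,
    map_smul, inner_smul_left, inner_smul_right, inner_conj_symm, Finset.mul_sum]
  rw [Finset.sum_comm]
  refine Finset.sum_congr rfl fun p _ => Finset.sum_congr rfl fun q _ => ?_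
  ring

open Filter Topology in
lemma tendsto_pairing_compression [CompleteSpace E] (A : E →L[ℂ] E) {T : E →L[ℂ] E}
    (hT : IsTraceClass T) :
    Tendsto (fun F => pairing b (compression b F A) T) atTop (𝓝 (pairing b A T)) := by
  obtain ⟨x, y, hxy, hT⟩ := hT
  simp only [pairing_eq_tsum_of_nuclear b _ hxy hT]
  have hP (z : E) : Tendsto (fun F : Finset κ => ∑ a ∈ F, ⟪b a, z⟫ • b a) atTop (𝓝 z) := by
    have := b.hasSum_repr z
    simpa only [b.repr_apply_apply, HasSum, SummationFilter.unconditional_filter] using this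
  refine tendsto_tsum_of_dominated_convergence (hxy.mul_left ‖A‖) (fun n => ?_)
    (Eventually.of_forall fun F n => ?_)
  · simp only [inner_compression]
    exact (hP _).inner ((A.continuous.tendsto _).comp (hP _))
  · rw [inner_compression]
    refine (norm_inner_le_norm _ _).trans ?_
    calc _ ≤ ‖y n‖ * (‖A‖ * ‖x n‖) := by
          refine mul_le_mul (norm_sum_inner_smul_le b F _) ?_ (norm_nonneg _) (norm_nonneg _)
          refine (A.le_opNorm _).trans ?_
          gcongr
          exact norm_sum_inner_smul_le b F _
      _ = ‖A‖ * (‖x n‖ * ‖y n‖) := by ring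

lemma MatPos.posSemidef {k : ℕ} {A : Fin k → Fin k → (E →L[ℂ] E)} (hA : MatPos A)
    (F : Finset κ) :
    (Matrix.of fun p q : Fin k × F => ⟪b p.2, A p.1 q.1 (b q.2)⟫).PosSemidef := by
  classical
  set M := Matrix.of fun p q : Fin k × F => ⟪b p.2, A p.1 q.1 (b q.2)⟫ with hM
  have key (c : Fin k × F → ℂ) : 0 ≤ star c ⬝ᵥ M.mulVec c := by
    convert hA (fun i => ∑ a : F, c (i, a) • b a) using 1
    simp only [hM, dotProduct, Matrix.mulVec, Matrix.of_apply, Fintype.sum_prod_type,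
      Finset.mul_sum,
      inner_sum, sum_inner, map_sum, map_smul, inner_smul_left, inner_smul_right, Pi.star_apply,
      RCLike.star_def]
    refine Finset.sum_congr rfl fun i _ => ?_
    rw [Finset.sum_comm]
    refine Finset.sum_congr rfl fun j _ => ?_
    rw [Finset.sum_comm]
    refine Finset.sum_congr rfl fun p _ => Finset.sum_congr rfl fun q _ => ?_
    ring
  rw [← Matrix.isPositive_toEuclideanLin_iff, LinearMap.isPositive_iff_complex]
  intro x
  have hx : ⟪M.toEuclideanLin x, x⟫ = star (star x.ofLp ⬝ᵥ M.mulVec x.ofLp) := by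
    rw [← inner_conj_symm, EuclideanSpace.inner_eq_star_dotProduct, dotProduct_comm]
    rfl
  have hpos := key x.ofLp
  rw [Complex.nonneg_iff] at hpos
  rw [hx]
  constructor
  · apply Complex.ext <;> simp [← hpos.2]
  · simpa using hpos.1

lemma MatPos.exists_compression_eq_sum_rankOne {k : ℕ} {A : Fin k → Fin k → (E →L[ℂ] E)}
    (hA : MatPos A) (F : Finset κ) :
    ∃ (N : ℕ) (u : Fin N → Fin k → E),
      ∀ i j, compression b F (A i j) = ∑ n, rankOne (u n i) (u n j) := by
  obtain ⟨N, c, hc⟩ := Matrix.posSemidef_iff_eq_sum_vecMulVec.1 (hA.posSemidef b F)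
  refine ⟨N, fun n i => ∑ a : F, c n (i, a) • b a, fun i j => ?_⟩
  have hc' (p q : Fin k × F) :
      ⟪b p.2, A p.1 q.1 (b q.2)⟫ = ∑ n, c n p * star (c n q) := by
    simpa [Matrix.sum_apply, Matrix.vecMulVec_apply] using congrFun (congrFun hc p) q
  ext z
  simp only [compression, sum_apply, smul_apply, rankOne_apply, sum_inner, inner_smul_left,
    hc' (i, _) (j, _), Finset.sum_smul, Finset.smul_sum, smul_smul]
  rw [Finset.sum_comm (s := (Finset.univ : Finset (Fin N)))]
  refine Finset.sum_congr rfl fun p _ => ?_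
  rw [Finset.sum_comm]
  refine Finset.sum_congr rfl fun n _ => ?_
  rw [← Finset.sum_smul, Finset.sum_mul]
  refine congrArg (· • b p) (Finset.sum_congr rfl fun q _ => ?_)
  rw [RCLike.star_def]
  ring

end Pairing

section HilbertSchmidt

variable {K : Type*} [NormedAddCommGroup K] [InnerProductSpace ℂ K]
  {H : Type*} [NormedAddCommGroup H] [InnerProductSpace ℂ H] [CompleteSpace H]
  {ι : Type*} {e : HilbertBasis ι ℂ K} (m : HSModel e H)

lemma isHS_rankOne (e : HilbertBasis ι ℂ K) (u v : K) : IsHS e (rankOne u v) := by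
  simp only [IsHS, rankOne_apply, norm_smul, mul_pow]
  refine Summable.mul_right _ ?_
  simpa only [norm_inner_symm] using e.orthonormal.inner_products_summable v

lemma rankLE_sum_rankOne {k : ℕ} (f g : Fin k → K) :
    rankLE (∑ i, rankOne (f i) (g i)) k := by
  have hle : LinearMap.range ((∑ i, rankOne (f i) (g i) : K →L[ℂ] K) : K →ₗ[ℂ] K) ≤
      Submodule.span ℂ (Set.range f) := by
    rintro _ ⟨z, rfl⟩
    simp only [coe_coe, sum_apply, rankOne_apply]
    exact Submodule.sum_mem _ fun i _ =>
      Submodule.smul_mem _ _ (Submodule.subset_span (Set.mem_range_self i))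
  refine (Submodule.rank_mono hle).trans ((rank_span_le _).trans ?_)
  have := Cardinal.mk_range_le_lift (f := f)
  simpa using this

lemma rankLE.exists_eq_sum_rankOne [CompleteSpace K] {k : ℕ} {T : K →L[ℂ] K} (hT : rankLE T k) :
    ∃ f g : Fin k → K, T = ∑ i, rankOne (f i) (g i) := by
  set R := LinearMap.range (T : K →ₗ[ℂ] K) with hR
  have : FiniteDimensional ℂ R :=
    Module.rank_lt_aleph0_iff.1 (lt_of_le_of_lt hT Cardinal.natCast_lt_aleph0)
  have hrk : Module.finrank ℂ R ≤ k := by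
    have := hT
    rw [rankLE, ← hR, ← Module.finrank_eq_rank] at this
    exact_mod_cast this
  set o := stdOrthonormalBasis ℂ R
  set f : Fin k → K := fun i => if h : i < Module.finrank ℂ R then (o ⟨i, h⟩ : K) else 0
  refine ⟨f, fun i => adjoint T (f i), ?_⟩
  ext z
  have hz : T z = ∑ j, ⟪(o j : K), T z⟫ • (o j : K) := by
    have := congrArg Subtype.val (o.sum_repr' (⟨T z, z, rfl⟩ : R))
    simpa using this.symm
  simp only [sum_apply, rankOne_apply, adjoint_inner_left]
  refine hz.trans (Fintype.sum_of_injective (Fin.castLE hrk) (Fin.castLE_injective hrk) _ _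
    (fun i hi => ?_) fun j => ?_)
  · have : ¬ (i : ℕ) < Module.finrank ℂ R := fun h => hi ⟨⟨i, h⟩, rfl⟩
    simp [f, this]
  · simp [f]

namespace HSModel

/-- The vector of `H` that represents the rank one operator `rankOne u v`. -/
def ofRankOne (u v : K) : H := ((m.mem_range _).1 (isHS_rankOne e u v)).choose

@[simp]
lemma toOp_ofRankOne (u v : K) : m.toOp (m.ofRankOne u v) = rankOne u v :=
  ((m.mem_range _).1 (isHS_rankOne e u v)).choose_spec

lemma rankLE_toOp_sum_ofRankOne {k : ℕ} (f g : Fin k → K) :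
    rankLE (m.toOp (∑ i, m.ofRankOne (f i) (g i))) k := by
  simpa using rankLE_sum_rankOne f g

variable [CompleteSpace K]

lemma inner_ofRankOne (u v : K) (y : H) : ⟪m.ofRankOne u v, y⟫ = ⟪u, m.toOp y v⟫ := by
  rw [m.inner_eq, ← adjoint_inner_left, ← inner_conj_symm,
    ← e.tsum_inner_mul_inner v (adjoint (m.toOp y) u), Complex.conj_tsum]
  refine tsum_congr fun i => ?_
  rw [toOp_ofRankOne, rankOne_apply, inner_smul_left, adjoint_inner_right, map_mul,
    inner_conj_symm, inner_conj_symm]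

lemma inner_ofRankOne_right (u v : K) (y : H) : ⟪y, m.ofRankOne u v⟫ = ⟪m.toOp y v, u⟫ := by
  rw [← inner_conj_symm, inner_ofRankOne, inner_conj_symm]

lemma ext_inner_ofRankOne {y z : H}
    (h : ∀ u v, ⟪m.ofRankOne u v, y⟫ = ⟪m.ofRankOne u v, z⟫) : y = z := by
  refine m.inj (ContinuousLinearMap.ext fun v => ext_inner_left ℂ fun u => ?_)
  rw [← inner_ofRankOne, ← inner_ofRankOne, h]

lemma norm_ofRankOne (u v : K) : ‖m.ofRankOne u v‖ = ‖u‖ * ‖v‖ := by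
  refine (sq_eq_sq₀ (norm_nonneg _) (by positivity)).1 ?_
  have h : ((‖m.ofRankOne u v‖ ^ 2 : ℝ) : ℂ) = (((‖u‖ * ‖v‖) ^ 2 : ℝ) : ℂ) := by
    push_cast
    rw [← RCLike.ofReal_eq_complex_ofReal, ← inner_self_eq_norm_sq_to_K (𝕜 := ℂ),
      inner_ofRankOne, toOp_ofRankOne, rankOne_apply, inner_smul_right,
      inner_self_eq_norm_sq_to_K, inner_self_eq_norm_sq_to_K]
    simp only [RCLike.ofReal_eq_complex_ofReal]
    ring
  exact_mod_cast h

lemma norm_toOp_apply_le (y : H) (v : K) : ‖m.toOp y v‖ ≤ ‖v‖ * ‖y‖ := by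
  by_cases h0 : ‖m.toOp y v‖ = 0
  · rw [h0]; positivity
  refine le_of_mul_le_mul_left ?_ (lt_of_le_of_ne (norm_nonneg _) (Ne.symm h0))
  calc ‖m.toOp y v‖ * ‖m.toOp y v‖ = ‖⟪m.ofRankOne (m.toOp y v) v, y⟫‖ := by
        rw [inner_ofRankOne, inner_self_eq_norm_sq_to_K]; simp [pow_two]
    _ ≤ ‖m.ofRankOne (m.toOp y v) v‖ * ‖y‖ := norm_inner_le_norm _ _
    _ = ‖m.toOp y v‖ * (‖v‖ * ‖y‖) := by rw [norm_ofRankOne, mul_assoc]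

/-- Evaluation of a Hilbert–Schmidt operator at a vector, as a bounded operator `H → K`. -/
def evalCLM (v : K) : H →L[ℂ] K :=
  LinearMap.mkContinuous
    { toFun := fun y => m.toOp y v
      map_add' := fun y z => by simp
      map_smul' := fun c y => by simp } ‖v‖ fun y => m.norm_toOp_apply_le y v

@[simp]
lemma evalCLM_apply (v : K) (y : H) : m.evalCLM v y = m.toOp y v := rfl

lemma dense_span_ofRankOne :
    Dense (Submodule.span ℂ (Set.range fun p : K × K => m.ofRankOne p.1 p.2) : Set H) := by
  rw [Submodule.dense_iff_topologicalClosure_eq_top, Submodule.topologicalClosure_eq_top_iff,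
    Submodule.eq_bot_iff]
  intro z hz
  refine m.ext_inner_ofRankOne fun u v => ?_
  rw [inner_zero_right]
  exact (Submodule.mem_orthogonal _ _).1 hz _ (Submodule.subset_span ⟨(u, v), rfl⟩)

lemma rankOne_ofRankOne_eq (u v u' v' : K) :
    rankOne (m.ofRankOne u' v') (m.ofRankOne u v) =
      m.Rmul (rankOne v v') ∘L m.Lmul (rankOne u' u) := by
  ext z
  refine m.inj (ContinuousLinearMap.ext fun t => ?_)
  simp only [rankOne_apply, inner_ofRankOne, comp_apply, Rmul_eq, Lmul_eq, map_smul,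
    toOp_ofRankOne, smul_apply, smul_smul]
  rw [mul_comm]

variable {m} {φ : (K →L[ℂ] K) →ₗ[ℂ] (K →L[ℂ] K)} {Φ Φst : (H →L[ℂ] H) →ₗ[ℂ] (H →L[ℂ] H)}

/-- The values of the extension of `φ` on rank one operators between finite rank vectors. -/
lemma inner_ext_rankOne_ofRankOne (hext : HSExt m φ Φ) (u v u' v' : K) (x x' : H) :
    ⟪x', Φ (rankOne (m.ofRankOne u' v') (m.ofRankOne u v)) x⟫ =
      ⟪m.toOp x' v', φ (rankOne u' u) (m.toOp x v)⟫ := by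
  rw [rankOne_ofRankOne_eq, hext, ← inner_ofRankOne_right]
  congr 1
  refine m.inj (ContinuousLinearMap.ext fun t => ?_)
  simp [Rmul_eq, Lmul_eq]

/-- The values of the extension of `φ` on arbitrary rank one operators, seen through finite rank
vectors. -/
lemma inner_ofRankOne_ext_rankOne {κ : Type*} {b : HilbertBasis κ ℂ H}
    (hext : HSExt m φ Φ) (hnp : IsNormalPair b Φ Φst)
    {φst : (K →L[ℂ] K) →ₗ[ℂ] (K →L[ℂ] K)} (hφ : IsNormalPair e φ φst)
    (f g f' g' : K) (y y' : H) :
    ⟪m.ofRankOne f' g', Φ (rankOne y' y) (m.ofRankOne f g)⟫ =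
      ⟪f', φ (rankOne (m.toOp y' g') (m.toOp y g)) f⟫ := by
  set S := Φst (rankOne (m.ofRankOne f g) (m.ofRankOne f' g'))
  set s := φst (rankOne f f')
  have hS (y y' : H) : ⟪m.ofRankOne f' g', Φ (rankOne y' y) (m.ofRankOne f g)⟫ = ⟪y, S y'⟫ := by
    rw [← pairing_rankOne_right b, hnp.2 _ _ (isTraceClass_rankOne _ _), pairing_rankOne_left]
  have hs (w w' : K) : ⟪f', φ (rankOne w' w) f⟫ = ⟪w, s w'⟫ := by
    rw [← pairing_rankOne_right e, hφ.2 _ _ (isTraceClass_rankOne _ _), pairing_rankOne_left]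
  have hrank (u v u' v' : K) : ⟪m.ofRankOne u v, S (m.ofRankOne u' v')⟫ =
      ⟪m.ofRankOne u v, (adjoint (m.evalCLM g) ∘L s ∘L m.evalCLM g') (m.ofRankOne u' v')⟫ := by
    rw [← hS, inner_ext_rankOne_ofRankOne hext]
    simp only [comp_apply, adjoint_inner_right, evalCLM_apply, toOp_ofRankOne, rankOne_apply,
      map_smul, inner_smul_left, inner_smul_right, inner_conj_symm, hs]
    ring
  have hSs : S = adjoint (m.evalCLM g) ∘L s ∘L m.evalCLM g' := by
    refine ContinuousLinearMap.ext_on m.dense_span_ofRankOne ?_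
    rintro _ ⟨⟨u', v'⟩, rfl⟩
    exact m.ext_inner_ofRankOne fun u v => hrank u v u' v'
  rw [hS, hs, hSs]
  simp [adjoint_inner_right]

lemma denseRange_toOp_of_separating {x0 : H}
    (hsep : ∀ a : K →L[ℂ] K, m.Lmul a x0 = 0 → m.Lmul a = 0) : DenseRange (m.toOp x0) := by
  change Dense ((LinearMap.range (m.toOp x0 : K →ₗ[ℂ] K) : Submodule ℂ K) : Set K)
  rw [Submodule.dense_iff_topologicalClosure_eq_top, Submodule.topologicalClosure_eq_top_iff,
    Submodule.eq_bot_iff]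
  intro w hw
  have hzero : m.Lmul (rankOne w w) x0 = 0 := by
    refine m.inj (ContinuousLinearMap.ext fun v => ?_)
    have : ⟪w, m.toOp x0 v⟫ = 0 := Submodule.inner_left_of_mem_orthogonal
      (LinearMap.mem_range_self (m.toOp x0 : K →ₗ[ℂ] K) v) hw
    simp [Lmul_eq, this]
  have h : m.toOp (m.Lmul (rankOne w w) (m.ofRankOne w w)) w = 0 := by simp [hsep _ hzero]
  simpa [Lmul_eq] using h

/-- Every vector of rank at most `k` is a sum of `k` rank one vectors. -/
lemma exists_eq_sum_ofRankOne {k : ℕ} {x : H} (hx : rankLE (m.toOp x) k) :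
    ∃ f g : Fin k → K, x = ∑ i, m.ofRankOne (f i) (g i) := by
  obtain ⟨f, g, hfg⟩ := hx.exists_eq_sum_rankOne
  exact ⟨f, g, m.inj (by simp [hfg])⟩

end HSModel

lemma matPos_rankOne {k : ℕ} (u : Fin k → K) : MatPos fun i j => rankOne (u i) (u j) := by
  intro v
  have h : ∑ i, ∑ j, ⟪v i, rankOne (u i) (u j) (v j)⟫ =
      star (∑ i, ⟪u i, v i⟫) * ∑ i, ⟪u i, v i⟫ := by
    simp only [rankOne_apply, inner_smul_right, star_sum, Finset.sum_mul, Finset.mul_sum,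
      RCLike.star_def, inner_conj_symm]
    rw [Finset.sum_comm]
    exact Finset.sum_congr rfl fun i _ => Finset.sum_congr rfl fun j _ => mul_comm _ _
  rw [h]
  exact star_mul_self_nonneg _

variable [CompleteSpace K]

/-- For a normal map, `k`-positivity may be tested on matrices of rank one. -/
lemma kPos_iff_rankOne {k : ℕ} {φ φst : (K →L[ℂ] K) →ₗ[ℂ] (K →L[ℂ] K)}
    (hφ : IsNormalPair e φ φst) :
    kPos k φ ↔ ∀ u v : Fin k → K, 0 ≤ ∑ i, ∑ j, ⟪v i, φ (rankOne (u i) (u j)) (v j)⟫ := by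
  refine ⟨fun h u v => h _ (matPos_rankOne u) v, fun h A hA v => ?_⟩
  have hpair (B : K →L[ℂ] K) (i j : Fin k) :
      ⟪v i, φ B (v j)⟫ = pairing e B (φst (rankOne (v j) (v i))) := by
    rw [← pairing_rankOne_right e, hφ.2 _ _ (isTraceClass_rankOne _ _)]
  have hlim : Filter.Tendsto
      (fun F => ∑ i, ∑ j, ⟪v i, φ (compression e F (A i j)) (v j)⟫) Filter.atTop
      (nhds (∑ i, ∑ j, ⟪v i, φ (A i j) (v j)⟫)) := by
    refine tendsto_finsetSum _ fun i _ => tendsto_finsetSum _ fun j _ => ?_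
    simp only [hpair]
    exact tendsto_pairing_compression e _ (hφ.1 _ (isTraceClass_rankOne _ _))
  refine ge_of_tendsto' hlim fun F => ?_
  obtain ⟨N, u, hu⟩ := hA.exists_compression_eq_sum_rankOne e F
  have : ∑ i, ∑ j, ⟪v i, φ (compression e F (A i j)) (v j)⟫ =
      ∑ n, ∑ i, ∑ j, ⟪v i, φ (rankOne (u n i) (u n j)) (v j)⟫ := by
    simp only [hu, map_sum, sum_apply, inner_sum]
    rw [Finset.sum_comm (s := (Finset.univ : Finset (Fin N)))]
    exact Finset.sum_congr rfl fun i _ => Finset.sum_comm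
  rw [this]
  exact Finset.sum_nonneg fun n _ => h _ _

lemma continuous_sum_inner_rankOne_left {k : ℕ} {φ φst : (K →L[ℂ] K) →ₗ[ℂ] (K →L[ℂ] K)}
    (hφ : IsNormalPair e φ φst) (v : Fin k → K) :
    Continuous fun u : Fin k → K => ∑ i, ∑ j, ⟪v i, φ (rankOne (u i) (u j)) (v j)⟫ := by
  have hpair (u : Fin k → K) (i j : Fin k) : ⟪v i, φ (rankOne (u i) (u j)) (v j)⟫ =
      ⟪u j, φst (rankOne (v j) (v i)) (u i)⟫ := by
    rw [← pairing_rankOne_right e, hφ.2 _ _ (isTraceClass_rankOne _ _), pairing_rankOne_left]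
  simp only [hpair]
  fun_prop

end HilbertSchmidt

/-- Theorem 5.1.  Let `B(K)` act on `H = HS(K)` by left
multiplications with separating and cyclic vector `x0`.  For a normal
completely bounded `φ : B(K) → B(K)` (with normal extension `Φ` of `φ̃` and
predual `Φst`), the following are equivalent: (i) `φ` is `k`-positive;
(ii) `⟨C_φ, ω_{x,x}⟩ ≥ 0` for every `x ∈ HS(K)` with `rank x ≤ k`;
(iii) `⟨x ⊠ x, D_φ⟩ ≥ 0` for every `x ∈ HS(K)` with `rank x ≤ k`. -/
theorem statement11
    {K : Type*} [NormedAddCommGroup K] [InnerProductSpace ℂ K] [CompleteSpace K]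
    [TopologicalSpace.SeparableSpace K]
    {ι : Type*} (e : HilbertBasis ι ℂ K)
    {H : Type*} [NormedAddCommGroup H] [InnerProductSpace ℂ H] [CompleteSpace H]
    {ιH : Type*} (bH : HilbertBasis ιH ℂ H)
    (m : HSModel e H) (x0 : H) (hx0 : ‖x0‖ = 1)
    (hcyc : Dense {y : H | ∃ a : K →L[ℂ] K, m.Lmul a x0 = y})
    (hsep : ∀ a : K →L[ℂ] K, m.Lmul a x0 = 0 → m.Lmul a = 0)
    (k : ℕ)
    (φ : (K →L[ℂ] K) →ₗ[ℂ] (K →L[ℂ] K)) (hφ : NormalCB e φ)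
    (Φ Φst : (H →L[ℂ] H) →ₗ[ℂ] (H →L[ℂ] H))
    (hext : HSExt m φ Φ) (hnp : IsNormalPair bH Φ Φst) :
    List.TFAE [kPos k φ,
      ∀ x : H, rankLE (m.toOp x) k → 0 ≤ pairing bH (Φ (rankOne x0 x0)) (rankOne x x),
      ∀ x : H, rankLE (m.toOp x) k → 0 ≤ pairing bH (rankOne x x) (Φst (rankOne x0 x0))] := by
  obtain ⟨⟨φst, hφst⟩, -⟩ := hφ
  have hdense : DenseRange (Pi.map fun _ : Fin k => m.toOp x0) :=
    DenseRange.piMap fun _ => HSModel.denseRange_toOp_of_separating hsep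
  have hC (f g : Fin k → K) :
      pairing bH (Φ (rankOne x0 x0))
          (rankOne (∑ i, m.ofRankOne (f i) (g i)) (∑ i, m.ofRankOne (f i) (g i))) =
        ∑ i, ∑ j, ⟪f i, φ (rankOne (m.toOp x0 (g i)) (m.toOp x0 (g j))) (f j)⟫ := by
    rw [pairing_rankOne_right]
    simp only [map_sum, sum_inner, inner_sum,
      HSModel.inner_ofRankOne_ext_rankOne hext hnp hφst]
    exact Finset.sum_comm
  have hD (f g : Fin k → K) :
      pairing bH
          (rankOne (∑ i, m.ofRankOne (f i) (g i)) (∑ i, m.ofRankOne (f i) (g i)))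
          (Φst (rankOne x0 x0)) =
        ∑ i, ∑ j, ⟪m.toOp x0 (g i), φ (rankOne (f i) (f j)) (m.toOp x0 (g j))⟫ := by
    have hsum : rankOne (∑ i, m.ofRankOne (f i) (g i)) (∑ i, m.ofRankOne (f i) (g i)) =
        ∑ i, ∑ j, rankOne (m.ofRankOne (f i) (g i)) (m.ofRankOne (f j) (g j)) := by
      ext z
      simp only [rankOne_apply, sum_apply, sum_inner, Finset.sum_smul, Finset.smul_sum]
    rw [← hnp.2 _ _ (isTraceClass_rankOne _ _), pairing_rankOne_right, hsum]
    simp only [map_sum, sum_apply, inner_sum, HSModel.inner_ext_rankOne_ofRankOne hext]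
  tfae_have 1 → 2 := fun h x hx => by
    obtain ⟨f, g, rfl⟩ := HSModel.exists_eq_sum_ofRankOne hx
    rw [hC]
    exact (kPos_iff_rankOne hφst).1 h _ _
  tfae_have 1 → 3 := fun h x hx => by
    obtain ⟨f, g, rfl⟩ := HSModel.exists_eq_sum_ofRankOne hx
    rw [hD]
    exact (kPos_iff_rankOne hφst).1 h _ _
  tfae_have 2 → 1 := fun h => (kPos_iff_rankOne hφst).2 fun u v => by
    refine hdense.induction_on u
      (isClosed_Ici.preimage (continuous_sum_inner_rankOne_left hφst v)) fun g => ?_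
    have := h _ (m.rankLE_toOp_sum_ofRankOne v g)
    rwa [hC] at this
  tfae_have 3 → 1 := fun h => (kPos_iff_rankOne hφst).2 fun u v => by
    refine hdense.induction_on v (isClosed_Ici.preimage
      (f := fun v : Fin k → K => ∑ i, ∑ j, ⟪v i, φ (rankOne (u i) (u j)) (v j)⟫)
      (continuous_finsetSum _ fun i _ => continuous_finsetSum _ fun j _ => by fun_prop)) fun g => ?_
    have := h _ (m.rankLE_toOp_sum_ofRankOne u g)
    rwa [hD] at this
  tfae_finish

end ChoiInf
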